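/- arXiv:1403.1959 — 9 statements merged into one kernel-verified Lean document; each statement's English description precedes it below -/
import Mathlib

section
/- Let V be a finite-dimensional real vector space, B a nondegenerate symmetric bilinear form on V, and × a cross product on (V, B). Then for all x, y ∈ V one has x × (x × y) = −B(x,x)·y + B(x,y)·x. -/
/-- For a cross product `×` on `(V, B)` with `B` a nondegenerate symmetric bilinear form,
`x × (x × y) = −B(x,x)·y + B(x,y)·x` for all `x, y`. -/
theorem stmt_0 (V : Type*) [AddCommGroup V] [Module ℝ V] [FiniteDimensional ℝ V]
    (B : V →ₗ[ℝ] V →ₗ[ℝ] ℝ) (cross : V →ₗ[ℝ] V →ₗ[ℝ] V)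
    (hsymm : ∀ x y, B x y = B y x)
    (hnd : ∀ x, (∀ y, B x y = 0) → x = 0)
    (hskew : ∀ x y, cross x y = - cross y x)
    (horth : ∀ x y, B (cross x y) x = 0)
    (hcomp : ∀ x y, B (cross x y) (cross x y) = B x x * B y y - (B x y) ^ 2) :
    ∀ x y, cross x (cross x y) = -((B x x) • y) + (B x y) • x := by
  intro x y
  have horth' : ∀ a, B (cross x a) a = 0 := fun a => by
    rw [hskew x a, map_neg, LinearMap.neg_apply, horth, neg_zero]
  have hadj : ∀ a b, B (cross x a) b = -B a (cross x b) := fun a b => by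
    have h := horth' (a + b)
    simp only [map_add, LinearMap.add_apply, horth'] at h
    linarith [hsymm a (cross x b)]
  have hpol : ∀ z, B (cross x y) (cross x z) = B x x * B y z - B x y * B x z := fun z => by
    have h := hcomp x (y + z)
    simp only [map_add, LinearMap.add_apply] at h
    linarith [hcomp x y, hcomp x z, hsymm (cross x y) (cross x z),
      congrArg (B x x * ·) (hsymm y z)]
  rw [← sub_eq_zero]
  refine hnd _ fun z => ?_
  simp only [map_sub, map_add, map_neg, map_smul, LinearMap.sub_apply, LinearMap.add_apply,
    LinearMap.neg_apply, LinearMap.smul_apply, smul_eq_mul]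
  rw [hadj, hpol]
  ring
end

section
/- Let V be a finite-dimensional real vector space, B a nondegenerate symmetric bilinear form on V, × a cross product on (V, B), and ε ∈ {−1, +1}. If x ∈ V satisfies B(x,x) = −ε, then the map J_x(y) := −(x × y) maps the orthogonal complement x^⊥ = {y ∈ V : B(x,y) = 0} into itself, and J_x(J_x(y)) = ε·y for every y ∈ x^⊥; that is, the restriction of J_x to x^⊥ is an ε-complex structure (a complex structure if ε = −1, a paracomplex-type involution square if ε = +1). -/
/-- If `B(x,x) = -ε` with `ε = ±1`, then `J_x : y ↦ -(x × y)` maps `x^⊥` into itself and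
squares to `ε · id` on `x^⊥`, i.e. restricts to an `ε`-complex structure on `x^⊥`. -/
theorem stmt_3 (V : Type*) [AddCommGroup V] [Module ℝ V] [FiniteDimensional ℝ V]
    (B : V →ₗ[ℝ] V →ₗ[ℝ] ℝ) (cross : V →ₗ[ℝ] V →ₗ[ℝ] V)
    (hsymm : ∀ x y, B x y = B y x)
    (hnd : ∀ x, (∀ y, B x y = 0) → x = 0)
    (hskew : ∀ x y, cross x y = - cross y x)
    (horth : ∀ x y, B (cross x y) x = 0)
    (hcomp : ∀ x y, B (cross x y) (cross x y) = B x x * B y y - (B x y) ^ 2)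
    (ε : ℝ) (hε : ε = -1 ∨ ε = 1)
    (x : V) (hx : B x x = -ε) :
    ∀ y, B x y = 0 →
      B x (-(cross x y)) = 0 ∧ -(cross x (-(cross x y))) = ε • y := by
  intro y hy
  have swap : ∀ a b c, B (cross a b) c = - B (cross c b) a := by
    intro a b c
    have h := horth (a + c) b
    simp only [map_add, LinearMap.add_apply, horth] at h
    linarith
  have polar : ∀ z, B (cross x z) (cross x y) = B x x * B z y - B x z * B x y := by
    intro z
    have h := hcomp x (z + y)
    simp only [map_add, LinearMap.add_apply] at h
    rw [hcomp x z, hcomp x y, hsymm (cross x y) (cross x z), hsymm y z] at h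
    linarith
  refine ⟨by rw [map_neg, hsymm, horth, neg_zero], ?_⟩
  rw [map_neg, neg_neg, ← sub_eq_zero]
  apply hnd
  intro z
  have h₁ := swap x (cross x y) z
  have h₂ := swap (cross x y) z x
  have h₃ := polar z
  rw [hskew z (cross x y), map_neg, LinearMap.neg_apply] at h₁
  rw [hx, hy] at h₃
  rw [map_sub, LinearMap.sub_apply, map_smul, LinearMap.smul_apply, smul_eq_mul, hsymm y z]
  linarith
end

section
/- Let V be a finite-dimensional real vector space, B a nondegenerate symmetric bilinear form on V, and × a cross product on (V, B). If x ∈ V is null (B(x,x) = 0) and nonzero, then the kernel of J_x is totally isotropic: every y ∈ V with x × y = 0 satisfies B(y,y) = 0. -/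
/-- If `x` is null and nonzero, then the kernel of `J_x : y ↦ -(x × y)` is totally isotropic:
`x × y = 0` implies `B(y,y) = 0`. -/
theorem stmt_4 (V : Type*) [AddCommGroup V] [Module ℝ V] [FiniteDimensional ℝ V]
    (B : V →ₗ[ℝ] V →ₗ[ℝ] ℝ) (cross : V →ₗ[ℝ] V →ₗ[ℝ] V)
    (hsymm : ∀ x y, B x y = B y x)
    (hnd : ∀ x, (∀ y, B x y = 0) → x = 0)
    (hskew : ∀ x y, cross x y = - cross y x)
    (horth : ∀ x y, B (cross x y) x = 0)
    (hcomp : ∀ x y, B (cross x y) (cross x y) = B x x * B y y - (B x y) ^ 2)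
    (x : V) (hxnull : B x x = 0) (hxne : x ≠ 0) :
    ∀ y, cross x y = 0 → B y y = 0 := by
  intro y hxy
  have hyx : cross y x = 0 := by rw [hskew, hxy, neg_zero]
  have hBxy : B x y = 0 := by
    have h := hcomp x y
    simp only [hxy, map_zero, hxnull, zero_mul, zero_sub] at h
    exact pow_eq_zero_iff two_ne_zero |>.mp (by linarith)
  have hByx : B y x = 0 := by rw [hsymm, hBxy]
  by_contra hyy
  refine hxne (hnd x fun z => ?_)
  -- Polarize `hcomp y` in its second argument: `y × (x + z) = y × z`.
  have h₁ := hcomp y z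
  have h₂ := hcomp y (x + z)
  simp only [map_add, LinearMap.add_apply, hyx, zero_add, hxnull, hByx, hsymm z x] at h₂
  have h : B y y * B x z = 0 := by linarith
  exact (mul_eq_zero.mp h).resolve_left hyy
end

section
/- Let V be a finite-dimensional real vector space, B a nondegenerate symmetric bilinear form on V, and × a cross product on (V, B). If x ∈ V is null (B(x,x) = 0) and nonzero, then the kernel of J_x ∘ J_x equals the orthogonal complement of x: {y ∈ V : x × (x × y) = 0} = {y ∈ V : B(x, y) = 0}. -/
/-- If `x` is null and nonzero, then `ker (J_x ∘ J_x) = x^⊥`: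
`x × (x × y) = 0` iff `B(x,y) = 0`. -/
theorem stmt_5 (V : Type*) [AddCommGroup V] [Module ℝ V] [FiniteDimensional ℝ V]
    (B : V →ₗ[ℝ] V →ₗ[ℝ] ℝ) (cross : V →ₗ[ℝ] V →ₗ[ℝ] V)
    (hsymm : ∀ x y, B x y = B y x)
    (hnd : ∀ x, (∀ y, B x y = 0) → x = 0)
    (hskew : ∀ x y, cross x y = - cross y x)
    (horth : ∀ x y, B (cross x y) x = 0)
    (hcomp : ∀ x y, B (cross x y) (cross x y) = B x x * B y y - (B x y) ^ 2)
    (x : V) (hxnull : B x x = 0) (hxne : x ≠ 0) :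
    {y : V | cross x (cross x y) = 0} = {y : V | B x y = 0} := by
  have hskewadj : ∀ u v, B (cross x u) v = - B (cross x v) u := by
    intro u v
    have hself : ∀ w, B (cross x w) w = 0 := fun w => by
      rw [hskew, map_neg, LinearMap.neg_apply, horth, neg_zero]
    have h := hself (u + v)
    simp only [map_add, LinearMap.add_apply, hself] at h
    linarith
  have hpolar : ∀ y z, B (cross x y) (cross x z) = - (B x y * B x z) := by
    intro y z
    have h := hcomp x (y + z)
    have hy := hcomp x y
    have hz := hcomp x z
    simp only [map_add, LinearMap.add_apply, hxnull] at h hy hz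
    rw [hsymm (cross x z) (cross x y)] at h
    linarith
  have hsq : ∀ y, cross x (cross x y) = B x y • x := by
    intro y
    refine sub_eq_zero.mp (hnd _ fun z => ?_)
    rw [map_sub, map_smul, LinearMap.sub_apply, LinearMap.smul_apply, hskewadj, hpolar,
      smul_eq_mul]
    ring
  ext y
  simp [hsq, hxne]
end

section
/- Let V be a 7-dimensional real vector space, B a nondegenerate symmetric bilinear form on V, and × a cross product on (V, B). If x ∈ V is null (B(x,x) = 0) and nonzero, then the kernel of J_x has dimension 3. -/
/-- In dimension 7, for `x` null and nonzero, the kernel of `J_x = -(x × ·)` has dimension 3. -/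
theorem stmt_6 (V : Type*) [AddCommGroup V] [Module ℝ V] [FiniteDimensional ℝ V]
    (hdim : Module.finrank ℝ V = 7)
    (B : V →ₗ[ℝ] V →ₗ[ℝ] ℝ) (cross : V →ₗ[ℝ] V →ₗ[ℝ] V)
    (hsymm : ∀ x y, B x y = B y x)
    (hnd : ∀ x, (∀ y, B x y = 0) → x = 0)
    (hskew : ∀ x y, cross x y = - cross y x)
    (horth : ∀ x y, B (cross x y) x = 0)
    (hcomp : ∀ x y, B (cross x y) (cross x y) = B x x * B y y - (B x y) ^ 2)
    (x : V) (hxnull : B x x = 0) (hxne : x ≠ 0) :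
    Module.finrank ℝ (LinearMap.ker (-(cross x))) = 3 := by
  have hskewB : ∀ u y z, B (cross u y) z = - B y (cross u z) := by
    intro u y z
    have h1 : ∀ u v w, B (cross u v) w = - B (cross w v) u := by
      intro u v w
      have h := horth (u + w) v
      simp only [map_add, LinearMap.add_apply, horth] at h
      linarith
    have h2 := h1 y u z
    rw [hskew y u, hskew z u, hsymm _ y] at h2
    simp only [map_neg, LinearMap.neg_apply] at h2
    linarith
  have hpolar : ∀ u y z, B (cross u y) (cross u z) = B u u * B y z - B u y * B u z := by
    intro u y z
    have h := hcomp u (y + z)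
    have hy := hcomp u y
    have hz := hcomp u z
    simp only [map_add, LinearMap.add_apply] at h
    rw [hsymm (cross u z) (cross u y), hsymm z y] at h
    linarith
  have hsq : ∀ u y, cross u (cross u y) = B u y • u - B u u • y := by
    intro u y
    refine sub_eq_zero.1 (hnd _ fun z => ?_)
    have h1 := hskewB u (cross u y) z
    rw [hpolar] at h1
    simp only [map_sub, map_smul, LinearMap.sub_apply, LinearMap.smul_apply, smul_eq_mul]
    linarith
  have hker_orth : ∀ y, cross x y = 0 → B x y = 0 := by
    intro y hy
    have h := hsq x y
    simpa [hy, hxnull, hxne] using h.symm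
  have hker_null : ∀ y, cross x y = 0 → B y y = 0 := by
    intro y hy
    have h := hsq y x
    rw [hskew y x, hy, hsymm y x, hker_orth y hy] at h
    simpa [hxne] using h
  rw [LinearMap.ker_neg]
  set K := LinearMap.ker (cross x) with hK
  apply le_antisymm
  · have hle : K ≤ LinearMap.BilinForm.orthogonal B K := by
      intro y hy z hz
      rw [hK, LinearMap.mem_ker] at hy hz
      have h := hker_null (y + z) (by rw [map_add, hy, hz, add_zero])
      simp only [map_add, LinearMap.add_apply, hker_null y hy, hker_null z hz, hsymm y z] at h
      change B z y = 0
      linarith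
    have hB : LinearMap.BilinForm.Nondegenerate B :=
      ⟨hnd, fun y hy => hnd y fun z => by rw [hsymm, hy]⟩
    have hfr := LinearMap.BilinForm.finrank_orthogonal hB K
    have := Submodule.finrank_mono hle
    omega
  · set H := LinearMap.ker (B x) with hH
    have hHdim : 6 ≤ Module.finrank ℝ H := by
      have h1 := LinearMap.finrank_range_add_finrank_ker (B x)
      have h2 := Submodule.finrank_le (LinearMap.range (B x))
      rw [Module.finrank_self] at h2
      rw [← hH] at h1
      omega
    have hrn := LinearMap.finrank_range_add_finrank_ker ((cross x).domRestrict H)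
    have hrange : LinearMap.range ((cross x).domRestrict H) ≤ K := by
      rintro _ ⟨⟨y, hy⟩, rfl⟩
      rw [hH, LinearMap.mem_ker] at hy
      rw [hK, LinearMap.mem_ker, LinearMap.domRestrict_apply, hsq, hy, hxnull]
      simp
    have hker : (LinearMap.ker ((cross x).domRestrict H)).map H.subtype ≤ K := by
      rintro _ ⟨y, hy, rfl⟩
      exact hy
    have h1 := Submodule.finrank_mono hrange
    have h2 := Submodule.finrank_mono hker
    rw [Submodule.finrank_map_subtype_eq] at h2
    omega
end

section
/- Let V be a 7-dimensional real vector space, B a nondegenerate symmetric bilinear form on V, and × a cross product on (V, B). If x ∈ V is null (B(x,x) = 0) and nonzero, then the image of J_x equals the orthogonal complement of the kernel of J_x: range(J_x) = (ker J_x)^⊥. -/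
/-- If `f` is skew-adjoint for a nondegenerate symmetric bilinear form `B`, then
`range f = (ker f)^⊥`. -/
theorem range_eq_orthogonal_ker_of_skewAdjoint {K V : Type*} [Field K] [AddCommGroup V]
    [Module K V] [FiniteDimensional K V] (B : LinearMap.BilinForm K V) (f : V →ₗ[K] V)
    (hB : B.Nondegenerate) (hsymm : B.IsSymm) (hf : ∀ y z, B (f y) z = -B y (f z)) :
    LinearMap.range f = B.orthogonal (LinearMap.ker f) := by
  have hker : LinearMap.ker f = B.orthogonal (LinearMap.range f) := by
    ext s
    simp only [LinearMap.mem_ker, LinearMap.BilinForm.mem_orthogonal_iff, LinearMap.mem_range,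
      forall_exists_index, forall_apply_eq_imp_iff, hf, neg_eq_zero]
    exact ⟨fun h z => by rw [h, map_zero], fun h => hB.2 _ h⟩
  rw [hker, LinearMap.BilinForm.orthogonal_orthogonal hB hsymm.isRefl]

/-- In dimension 7, for `x` null and nonzero, `range J_x = (ker J_x)^⊥`, where
`J_x : y ↦ -(x × y)` and `S^⊥ = {y : B(s,y) = 0 for all s ∈ S}`. -/
theorem stmt_7 (V : Type*) [AddCommGroup V] [Module ℝ V] [FiniteDimensional ℝ V]
    (hdim : Module.finrank ℝ V = 7)
    (B : V →ₗ[ℝ] V →ₗ[ℝ] ℝ) (cross : V →ₗ[ℝ] V →ₗ[ℝ] V)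
    (hsymm : ∀ x y, B x y = B y x)
    (hnd : ∀ x, (∀ y, B x y = 0) → x = 0)
    (hskew : ∀ x y, cross x y = - cross y x)
    (horth : ∀ x y, B (cross x y) x = 0)
    (hcomp : ∀ x y, B (cross x y) (cross x y) = B x x * B y y - (B x y) ^ 2)
    (x : V) (hxnull : B x x = 0) (hxne : x ≠ 0) :
    ∀ y : V, (∃ z, -(cross x z) = y) ↔ (∀ s, -(cross x s) = 0 → B s y = 0) := by
  have horth' : ∀ u v, B (cross u v) v = 0 := fun u v => by
    rw [hskew, map_neg, LinearMap.neg_apply, horth, neg_zero]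
  have hadj : ∀ y z, B ((-cross x) y) z = -B y ((-cross x) z) := fun y z => by
    have h := horth' x (y + z)
    simp only [map_add, LinearMap.add_apply, horth'] at h
    simp only [LinearMap.neg_apply, map_neg]
    linarith [hsymm y (cross x z)]
  have hB : LinearMap.BilinForm.Nondegenerate B :=
    ⟨hnd, fun y h => hnd y fun z => by rw [hsymm, h]⟩
  have key := range_eq_orthogonal_ker_of_skewAdjoint B (-cross x) hB ⟨hsymm⟩ hadj
  exact fun y => SetLike.ext_iff.mp key y
end

section
/- Let V be a 7-dimensional real vector space, B a nondegenerate symmetric bilinear form on V, and × a cross product on (V, B). If x ∈ V is null (B(x,x) = 0) and nonzero, then the image under J_x of the orthogonal complement of x equals the kernel of J_x: J_x(x^⊥) = ker J_x, where x^⊥ = {y ∈ V : B(x,y) = 0}. -/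
section CrossProduct

variable {V : Type*} [AddCommGroup V] [Module ℝ V]
  {B : V →ₗ[ℝ] V →ₗ[ℝ] ℝ} {cross : V →ₗ[ℝ] V →ₗ[ℝ] V}

theorem cross_triple_skew
    (hskew : ∀ x y, cross x y = - cross y x) (horth : ∀ x y, B (cross x y) x = 0)
    (x y z : V) : B (cross x y) z = - B (cross x z) y := by
  have h := horth (y + z) x
  rw [hskew] at h
  simp only [map_add, map_neg, LinearMap.neg_apply, LinearMap.add_apply] at h
  have h1 := horth y x
  have h2 := horth z x
  rw [hskew] at h1 h2
  simp only [map_neg, LinearMap.neg_apply] at h1 h2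
  linarith

theorem cross_cross_self
    (hsymm : ∀ x y, B x y = B y x) (hnd : ∀ x, (∀ y, B x y = 0) → x = 0)
    (hskew : ∀ x y, cross x y = - cross y x) (horth : ∀ x y, B (cross x y) x = 0)
    (hcomp : ∀ x y, B (cross x y) (cross x y) = B x x * B y y - (B x y) ^ 2)
    (x y : V) : cross x (cross x y) = B x y • x - B x x • y := by
  rw [← sub_eq_zero]
  refine hnd _ fun z => ?_
  have h1 := cross_triple_skew hskew horth x (cross x y) z
  have h2 := hcomp x (y + z)
  simp only [map_add, LinearMap.add_apply] at h2
  have h3 := hcomp x y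
  have h4 := hcomp x z
  have h5 := hsymm (cross x y) (cross x z)
  have h6 := hsymm y z
  simp only [map_sub, map_smul, LinearMap.sub_apply, LinearMap.smul_apply, smul_eq_mul]
  rw [← h6] at h2
  linear_combination h1 - h2 / 2 + h3 / 2 + h4 / 2 + h5 / 2

theorem cross_cross_add_cross_cross
    (hsymm : ∀ x y, B x y = B y x) (hnd : ∀ x, (∀ y, B x y = 0) → x = 0)
    (hskew : ∀ x y, cross x y = - cross y x) (horth : ∀ x y, B (cross x y) x = 0)
    (hcomp : ∀ x y, B (cross x y) (cross x y) = B x x * B y y - (B x y) ^ 2)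
    (x y z : V) : cross x (cross y z) + cross y (cross x z) =
      B x z • y + B y z • x - (2 * B x y) • z := by
  have key := cross_cross_self hsymm hnd hskew horth hcomp
  have h := key (x + y) z
  simp only [map_add, LinearMap.add_apply, key, hsymm y x] at h
  linear_combination (norm := module) h

/-- For `x` null and nonzero, the kernel of `y ↦ x × y` is contained in `x^⊥`. -/
theorem orthogonal_of_cross_eq_zero
    (hsymm : ∀ x y, B x y = B y x) (hnd : ∀ x, (∀ y, B x y = 0) → x = 0)
    (hskew : ∀ x y, cross x y = - cross y x) (horth : ∀ x y, B (cross x y) x = 0)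
    (hcomp : ∀ x y, B (cross x y) (cross x y) = B x x * B y y - (B x y) ^ 2)
    {x : V} (hxnull : B x x = 0) (hxne : x ≠ 0) {y : V} (hy : cross x y = 0) :
    B x y = 0 := by
  have h := cross_cross_self hsymm hnd hskew horth hcomp x y
  simpa [hy, hxnull, hxne] using h.symm

/-- For `x` null and nonzero, every vector in the kernel of `y ↦ x × y` is null. -/
theorem null_of_cross_eq_zero
    (hsymm : ∀ x y, B x y = B y x) (hnd : ∀ x, (∀ y, B x y = 0) → x = 0)
    (hskew : ∀ x y, cross x y = - cross y x) (horth : ∀ x y, B (cross x y) x = 0)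
    (hcomp : ∀ x y, B (cross x y) (cross x y) = B x x * B y y - (B x y) ^ 2)
    {x : V} (hxnull : B x x = 0) (hxne : x ≠ 0) {y : V} (hy : cross x y = 0) :
    B y y = 0 := by
  have hxy := orthogonal_of_cross_eq_zero hsymm hnd hskew horth hcomp hxnull hxne hy
  obtain ⟨z, hz⟩ : ∃ z, B x z ≠ 0 := by
    by_contra! h
    exact hxne (hnd x h)
  have h := congrArg (fun v => B v y)
    (cross_cross_add_cross_cross hsymm hnd hskew horth hcomp y z x)
  have hyx : cross y x = 0 := by rw [hskew, hy, neg_zero]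
  simpa [hyx, horth, hsymm y x, hxy, hsymm z x, hz] using h

end CrossProduct

/-- In dimension 7, for `x` null and nonzero, `J_x(x^⊥) = ker J_x`, where
`J_x : y ↦ -(x × y)` and `x^⊥ = {y : B(x,y) = 0}`. -/
theorem stmt_8 (V : Type*) [AddCommGroup V] [Module ℝ V] [FiniteDimensional ℝ V]
    (hdim : Module.finrank ℝ V = 7)
    (B : V →ₗ[ℝ] V →ₗ[ℝ] ℝ) (cross : V →ₗ[ℝ] V →ₗ[ℝ] V)
    (hsymm : ∀ x y, B x y = B y x)
    (hnd : ∀ x, (∀ y, B x y = 0) → x = 0)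
    (hskew : ∀ x y, cross x y = - cross y x)
    (horth : ∀ x y, B (cross x y) x = 0)
    (hcomp : ∀ x y, B (cross x y) (cross x y) = B x x * B y y - (B x y) ^ 2)
    (x : V) (hxnull : B x x = 0) (hxne : x ≠ 0) :
    ∀ y : V, (∃ z, B x z = 0 ∧ -(cross x z) = y) ↔ -(cross x y) = 0 := by
  set K := LinearMap.ker (cross x) with hK
  set P := LinearMap.ker (B x) with hP
  have hle : P.map (cross x) ≤ K := by
    rintro _ ⟨z, hz, rfl⟩
    have hz' : B x z = 0 := hz
    simp [hK, cross_cross_self hsymm hnd hskew horth hcomp, hxnull, hz']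
  have hKdim : Module.finrank ℝ K ≤ 3 := by
    have hrefl : LinearMap.IsRefl B := fun a b h => by rw [hsymm, h]
    have hnondeg : LinearMap.BilinForm.Nondegenerate B :=
      hrefl.nondegenerate_iff_separatingLeft.2 hnd
    have hiso : K ≤ LinearMap.BilinForm.orthogonal B K := by
      intro b hb a ha
      have null {v : V} (hv : v ∈ K) : B v v = 0 :=
        null_of_cross_eq_zero hsymm hnd hskew horth hcomp hxnull hxne hv
      have h := null (K.add_mem ha hb)
      simp only [map_add, LinearMap.add_apply, null ha, null hb, hsymm b a] at h
      change B a b = 0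
      linarith
    have h1 := Submodule.finrank_mono hiso
    rw [LinearMap.BilinForm.finrank_orthogonal hnondeg, hdim] at h1
    omega
  have hPdim : 6 ≤ Module.finrank ℝ P := by
    have h1 := LinearMap.finrank_range_add_finrank_ker (B x)
    have h2 := Submodule.finrank_le (LinearMap.range (B x))
    rw [← hP] at h1
    rw [Module.finrank_self] at h2
    omega
  have hmap : Module.finrank ℝ P ≤ Module.finrank ℝ (P.map (cross x)) + Module.finrank ℝ K := by
    have h1 := LinearMap.finrank_range_add_finrank_ker ((cross x).domRestrict P)
    rw [LinearMap.range_domRestrict] at h1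
    have h2 : Module.finrank ℝ (LinearMap.ker ((cross x).domRestrict P)) ≤ Module.finrank ℝ K := by
      rw [← Submodule.finrank_map_subtype_eq]
      refine Submodule.finrank_mono ?_
      rintro _ ⟨z, hz, rfl⟩
      exact hz
    omega
  have heq : P.map (cross x) = K := Submodule.eq_of_le_of_finrank_le hle (by omega)
  intro y
  rw [neg_eq_zero, ← LinearMap.mem_ker, ← hK, ← heq]
  constructor
  · rintro ⟨z, hz, rfl⟩
    exact neg_mem (Submodule.mem_map_of_mem hz)
  · rintro ⟨z, hz, rfl⟩
    have hz' : B x z = 0 := hz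
    exact ⟨-z, by simp [hz'], by simp⟩
end

section
/- Let V be a 7-dimensional real vector space, B a nondegenerate symmetric bilinear form on V, and × a cross product on (V, B). If x ∈ V is null (B(x,x) = 0) and nonzero, then the image under J_x of the orthogonal complement of the kernel of J_x equals the line spanned by x: J_x((ker J_x)^⊥) = span{x}. -/
section CrossProduct

variable {V : Type*} [AddCommGroup V] [Module ℝ V]
  {B : V →ₗ[ℝ] V →ₗ[ℝ] ℝ} {cross : V →ₗ[ℝ] V →ₗ[ℝ] V}

theorem cross_skewAdjoint (hsymm : ∀ x y, B x y = B y x)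
    (hskew : ∀ x y, cross x y = - cross y x) (horth : ∀ x y, B (cross x y) x = 0) (x y z : V) :
    B (cross x y) z = - B y (cross x z) := by
  have orth_right (w : V) : B (cross x w) w = 0 := by
    rw [hskew, map_neg, LinearMap.neg_apply, horth, neg_zero]
  have h := orth_right (y + z)
  simp only [map_add, LinearMap.add_apply, orth_right] at h
  rw [hsymm y]
  linarith

theorem cross_cross_self_of_null (hsymm : ∀ x y, B x y = B y x)
    (hnd : ∀ x, (∀ y, B x y = 0) → x = 0) (hskew : ∀ x y, cross x y = - cross y x)
    (horth : ∀ x y, B (cross x y) x = 0)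
    (hcomp : ∀ x y, B (cross x y) (cross x y) = B x x * B y y - (B x y) ^ 2)
    {x : V} (hx : B x x = 0) (y : V) : cross x (cross x y) = B x y • x := by
  refine sub_eq_zero.mp (hnd _ fun t => ?_)
  have h := hcomp x (y + t)
  simp only [map_add, LinearMap.add_apply, hcomp, hx, hsymm (cross x t) (cross x y)] at h
  rw [map_sub, LinearMap.sub_apply, cross_skewAdjoint hsymm hskew horth, map_smul,
    LinearMap.smul_apply, smul_eq_mul]
  linarith

end CrossProduct

theorem surjective_of_separatingLeft {V : Type*} [AddCommGroup V] [Module ℝ V]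
    [FiniteDimensional ℝ V] {B : V →ₗ[ℝ] V →ₗ[ℝ] ℝ} (hnd : ∀ x, (∀ y, B x y = 0) → x = 0) :
    Function.Surjective B := by
  have hinj : Function.Injective B :=
    (injective_iff_map_eq_zero B).mpr fun x hx => hnd x fun y => by simp [hx]
  exact (LinearMap.injective_iff_surjective_of_finrank_eq_finrank
    (Subspace.dual_finrank_eq (K := ℝ) (V := V)).symm).mp hinj


/-- In dimension 7, for `x` null and nonzero, `J_x((ker J_x)^⊥) = span{x}`, where
`J_x : y ↦ -(x × y)` and `S^⊥ = {y : B(s,y) = 0 for all s ∈ S}`. -/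
theorem stmt_9 (V : Type*) [AddCommGroup V] [Module ℝ V] [FiniteDimensional ℝ V]
    (hdim : Module.finrank ℝ V = 7)
    (B : V →ₗ[ℝ] V →ₗ[ℝ] ℝ) (cross : V →ₗ[ℝ] V →ₗ[ℝ] V)
    (hsymm : ∀ x y, B x y = B y x)
    (hnd : ∀ x, (∀ y, B x y = 0) → x = 0)
    (hskew : ∀ x y, cross x y = - cross y x)
    (horth : ∀ x y, B (cross x y) x = 0)
    (hcomp : ∀ x y, B (cross x y) (cross x y) = B x x * B y y - (B x y) ^ 2)
    (x : V) (hxnull : B x x = 0) (hxne : x ≠ 0) :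
    ∀ y : V, (∃ z, (∀ t, -(cross x t) = 0 → B t z = 0) ∧ -(cross x z) = y) ↔
      ∃ c : ℝ, y = c • x := by
  have hadj := cross_skewAdjoint hsymm hskew horth
  have hsq := cross_cross_self_of_null hsymm hnd hskew horth hcomp hxnull
  have hsurj := surjective_of_separatingLeft hnd
  intro y
  constructor
  · rintro ⟨z, hz, rfl⟩
    have hmem : B z ∈ LinearMap.range (cross x).dualMap := by
      rw [LinearMap.range_dualMap_eq_dualAnnihilator_ker, Submodule.mem_dualAnnihilator]
      intro t ht
      rw [hsymm]
      exact hz t (neg_eq_zero.mpr ht)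
    obtain ⟨φ, hφ⟩ := hmem
    obtain ⟨w, rfl⟩ := hsurj φ
    have hzw : z = -cross x w := by
      refine eq_neg_of_add_eq_zero_left (hnd _ fun t => ?_)
      rw [map_add, LinearMap.add_apply, hadj, ← hφ, LinearMap.dualMap_apply, add_neg_cancel]
    exact ⟨B x w, by rw [hzw, map_neg, neg_neg, hsq]⟩
  · rintro ⟨c, rfl⟩
    have hBx : B x ≠ 0 := fun h => hxne (hnd x fun t => by simp [h])
    obtain ⟨w, hw⟩ := LinearMap.surjective hBx c
    refine ⟨-cross x w, fun t ht => ?_, ?_⟩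
    · rw [map_neg, ← hadj, neg_eq_zero.mp ht, map_zero, LinearMap.zero_apply]
    · rw [map_neg, neg_neg, hsq, hw]
end

section
/- Let x, y be imaginary elements of the Cayley–Dickson algebra O_s = ℍ × ℍ (either sign s ∈ {−1, +1}), i.e. x̄ = −x and ȳ = −y. Define x × y := (1/2)(x·y − y·x) and ⟨x, y⟩ := Re(x·ȳ). Then x × y is again imaginary, and the two cross-product compatibility conditions hold: ⟨x × y, x⟩ = 0 and ⟨x × y, x × y⟩ = ⟨x, x⟩·⟨y, y⟩ − ⟨x, y⟩². (Thus the commutator product on the imaginary (split) octonions is a cross product for the inner product ⟨·,·⟩.) -/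
/-- The Cayley–Dickson multiplication on `ℍ × ℍ`:
`(a,b)(c,d) := (ac + s·(d·b̄), ā·d + c·b)`. For `s = -1` this gives the octonions,
for `s = +1` the split octonions. -/
noncomputable def cdMul (s : ℝ) (x y : Quaternion ℝ × Quaternion ℝ) :
    Quaternion ℝ × Quaternion ℝ :=
  (x.1 * y.1 + s • (y.2 * star x.2), star x.1 * y.2 + y.1 * x.2)

/-- Cayley–Dickson conjugation: the conjugate of `(a,b)` is `(ā, -b)`. -/
noncomputable def cdConj (x : Quaternion ℝ × Quaternion ℝ) : Quaternion ℝ × Quaternion ℝ :=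
  (star x.1, -x.2)

/-- The commutator cross product `x × y := (1/2)(x·y − y·x)` on `O_s`. -/
noncomputable def cdCross (s : ℝ) (x y : Quaternion ℝ × Quaternion ℝ) :
    Quaternion ℝ × Quaternion ℝ :=
  (1 / 2 : ℝ) • (cdMul s x y - cdMul s y x)

/-- The inner product `⟨x, y⟩ := Re(x · ȳ)` on `O_s`. -/
noncomputable def cdIp (s : ℝ) (x y : Quaternion ℝ × Quaternion ℝ) : ℝ :=
  (cdMul s x (cdConj y)).1.re

/-- For imaginary `x, y` in `O_s`, the commutator product `x × y` is again imaginary and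
satisfies the two cross-product compatibility conditions `⟨x × y, x⟩ = 0` and
`⟨x × y, x × y⟩ = ⟨x,x⟩·⟨y,y⟩ − ⟨x,y⟩²`. -/
theorem stmt_18 (s : ℝ) (hs : s = -1 ∨ s = 1)
    (x y : Quaternion ℝ × Quaternion ℝ)
    (hx : cdConj x = -x) (hy : cdConj y = -y) :
    cdConj (cdCross s x y) = -(cdCross s x y) ∧
    cdIp s (cdCross s x y) x = 0 ∧
    cdIp s (cdCross s x y) (cdCross s x y) =
      cdIp s x x * cdIp s y y - (cdIp s x y) ^ 2 := by
  obtain ⟨a, b⟩ := x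
  obtain ⟨c, d⟩ := y
  have ha : a.re = 0 := by
    have h : (star a).re = (-a).re := congrArg (fun z => z.1.re) hx
    rw [Quaternion.re_star, Quaternion.re_neg] at h
    linarith
  have hc : c.re = 0 := by
    have h : (star c).re = (-c).re := congrArg (fun z => z.1.re) hy
    rw [Quaternion.re_star, Quaternion.re_neg] at h
    linarith
  refine ⟨?_, ?_, ?_⟩
  · ext <;> simp [cdConj, cdCross, cdMul, ha, hc] <;> ring
  · simp [cdIp, cdConj, cdCross, cdMul, ha, hc]
    ring
  · simp [cdIp, cdConj, cdCross, cdMul, ha, hc]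
    ring
end
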